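/- Let p be a prime number and m an integer. Let W′ be the set of non-associative words in variables X, Z in which Z occurs exactly once, at the end, and X occurs at least twice. Then there exist integers γ_w for w ∈ W′, only finitely many of them nonzero (depending only on p and m), such that for every left brace (A,+,∘) of cardinality p^n with p > n+1 and all a, c ∈ A: (m·a)*c = m·(a*c) + Σ_{w∈W′} γ_w·w⟨a,c⟩, where w⟨a,c⟩ is the evaluation of w at X = a, Z = c under the operation *. -/

import Mathlib

universe u

/-- A left brace: `(A,+)` abelian group, `(A,∘)` a group, with
`a∘(b+c)+a = a∘b+a∘c`. -/
structure LeftBrace (A : Type u) [AddCommGroup A] where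
  circ : A → A → A
  one : A
  inv : A → A
  circ_assoc : ∀ a b c : A, circ (circ a b) c = circ a (circ b c)
  one_circ : ∀ a : A, circ one a = a
  circ_one : ∀ a : A, circ a one = a
  inv_circ : ∀ a : A, circ (inv a) a = one
  circ_add : ∀ a b c : A, circ a (b + c) + a = circ a b + circ a c

/-- `a*b = a∘b - a - b`. -/
def LeftBrace.star {A : Type u} [AddCommGroup A] (B : LeftBrace A) (a b : A) : A :=
  B.circ a b - a - b

/-- `ann(k) = {a : k•a = 0}`, as an additive subgroup. -/
def annSub (A : Type u) [AddCommGroup A] (k : ℕ) : AddSubgroup A where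
  carrier := {a : A | k • a = 0}
  zero_mem' := by simp
  add_mem' := by
    intro a b ha hb
    have ha' : k • a = 0 := ha
    have hb' : k • b = 0 := hb
    show k • (a + b) = 0
    rw [smul_add, ha', hb', add_zero]
  neg_mem' := by
    intro a ha
    have ha' : k • a = 0 := ha
    show k • (-a) = 0
    rw [smul_neg, ha', neg_zero]

/-- The coset `[a]` of `a` in `A/ann(k)`. -/
def qmk {A : Type u} [AddCommGroup A] (k : ℕ) (a : A) : A ⧸ annSub A k :=
  QuotientAddGroup.mk a

/-- Evaluation of a non-associative word under a binary operation `op`,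
substituting `f i` for the variable `i`. -/
def wEval {α : Type*} {β : Type*} (op : β → β → β) (f : α → β) : FreeMagma α → β
  | FreeMagma.of a => f a
  | FreeMagma.mul x y => op (wEval op f x) (wEval op f y)

/-- The list of leaves (occurrences of variables, left to right) of a word. -/
def wLeaves {α : Type*} : FreeMagma α → List α
  | FreeMagma.of a => [a]
  | FreeMagma.mul x y => wLeaves x ++ wLeaves y

/-- The last (rightmost) variable of a word. -/
def wLast {α : Type*} : FreeMagma α → α
  | FreeMagma.of a => a
  | FreeMagma.mul _ y => wLast y

/-- The number of occurrences of the variable `a` in a word. -/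
def wCount {α : Type*} [DecidableEq α] (a : α) : FreeMagma α → ℕ
  | FreeMagma.of b => if b = a then 1 else 0
  | FreeMagma.mul x y => wCount a x + wCount a y

/-- The length (number of variable occurrences) of a word. -/
def wLen {α : Type*} : FreeMagma α → ℕ
  | FreeMagma.of _ => 1
  | FreeMagma.mul x y => wLen x + wLen y

/-- Left-normed product `a₁·(a₂·(⋯(aₘ·b)⋯))`. -/
def leftProd {Q : Type*} (mul : Q → Q → Q) : List Q → Q → Q
  | [], b => b
  | a :: l, b => mul a (leftProd mul l b)

/-- `circPow B a k` is the product of `k` copies of `a` under `∘`. -/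
def circPow {A : Type u} [AddCommGroup A] (B : LeftBrace A) (a : A) : ℕ → A
  | 0 => B.one
  | k + 1 => B.circ a (circPow B a k)

/-- `eSeq B a (i-1)` is `a_i`, where `a_1 = a` and `a_{i+1} = a * a_i`. -/
def eSeq {A : Type u} [AddCommGroup A] (B : LeftBrace A) (a : A) : ℕ → A
  | 0 => a
  | i + 1 => B.star a (eSeq B a i)

/-- `starIter B a b (i-1)` is `e_i`, where `e_1 = a*b` and `e_{i+1} = a*e_i`. -/
def starIter {A : Type u} [AddCommGroup A] (B : LeftBrace A) (a b : A) : ℕ → A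
  | 0 => B.star a b
  | i + 1 => B.star a (starIter B a b i)

/-- `iterOp op u v i` is `u ⊙ (u ⊙ (⋯ (u ⊙ v)))` with `i` applications of `u ⊙ ·`. -/
def iterOp {Q : Type*} (op : Q → Q → Q) (u v : Q) : ℕ → Q
  | 0 => v
  | i + 1 => op u (iterOp op u v i)

/-- `f(a) = Σ_{i=1}^{p−1} (C(p−1,i−1)/i)·e_i` where `e_1 = a`, `e_{i+1} = a*e_i`. -/
def fMap {A : Type u} [AddCommGroup A] (B : LeftBrace A) (p : ℕ) (a : A) : A :=
  ∑ i ∈ Finset.Icc 1 (p - 1), (Nat.choose (p - 1) (i - 1) / i) • eSeq B a (i - 1)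

/-- `braceChainAux B (i-1)` is `A^i`: `A^1 = A`, `A^{i+1}` the additive subgroup
generated by `{x*y : x ∈ A, y ∈ A^i}`. -/
def braceChainAux {A : Type u} [AddCommGroup A] (B : LeftBrace A) : ℕ → AddSubgroup A
  | 0 => ⊤
  | i + 1 => AddSubgroup.closure {z : A | ∃ x : A, ∃ y ∈ braceChainAux B i, z = B.star x y}

/-- `dSeq B a b i = (d_i, d_i')`: `d_0 = a`, `d_0' = b`, `d_{i+1} = d_i + d_i'`,
`d_{i+1}' = d_i * d_i'`. -/
def dSeq {A : Type u} [AddCommGroup A] (B : LeftBrace A) (a b : A) : ℕ → A × A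
  | 0 => (a, b)
  | i + 1 => ((dSeq B a b i).1 + (dSeq B a b i).2, B.star (dSeq B a b i).1 (dSeq B a b i).2)

namespace LeftBrace
variable {A : Type u} [AddCommGroup A] (B : LeftBrace A)

lemma circ_zero' (a : A) : B.circ a 0 = a := by
  have := B.circ_add a 0 0
  rw [add_zero] at this
  exact (add_left_cancel this).symm

lemma one_eq : B.one = 0 := by
  rw [← B.circ_zero' B.one, B.one_circ]

lemma circ_inv' (a : A) : B.circ a (B.inv a) = B.one := by
  have h : B.circ (B.inv (B.inv a)) (B.circ (B.inv a) (B.circ a (B.inv a))) = B.one := by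
    rw [← B.circ_assoc (B.inv a), B.inv_circ, B.one_circ, B.inv_circ]
  rwa [← B.circ_assoc, B.inv_circ, B.one_circ] at h

lemma circ_eq (a b : A) : B.circ a b = a + b + B.star a b := by
  unfold star; abel

lemma star_add (a b c : A) : B.star a (b + c) = B.star a b + B.star a c := by
  have := B.circ_add a b c
  unfold star
  rw [eq_sub_of_add_eq this]; abel

lemma star_zero (a : A) : B.star a 0 = 0 := by
  have := B.star_add a 0 0
  simpa using this

lemma zero_star (c : A) : B.star 0 c = 0 := by
  unfold star
  rw [← B.one_eq, B.one_circ, B.one_eq]; abel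

lemma star_neg (a b : A) : B.star a (-b) = - B.star a b := by
  have := B.star_add a b (-b)
  rw [add_neg_cancel, star_zero] at this
  exact (neg_eq_of_add_eq_zero_right this.symm).symm

lemma star_sub (a b c : A) : B.star a (b - c) = B.star a b - B.star a c := by
  rw [sub_eq_add_neg, star_add, star_neg, sub_eq_add_neg]

lemma star_circ (a b c : A) :
    B.star (B.circ a b) c = B.star a c + B.star b c + B.star a (B.star b c) := by
  have h1 : B.star (B.circ a b) c = B.circ a (B.circ b c) - B.circ a b - c := by
    rw [← B.circ_assoc]; rfl
  rw [h1, B.circ_eq b c, B.circ_eq a, B.circ_eq a b, star_add, star_add]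
  abel

/-- the inverse of `λ_a` -/
def li (a z : A) : A := z + B.star (B.inv a) z

lemma li_eq (a z : A) : B.li a z + B.star a (B.li a z) = z := by
  have h := B.star_circ a (B.inv a) z
  rw [circ_inv', one_eq, zero_star] at h
  unfold li
  rw [star_add]
  calc _ = z + (B.star a z + B.star (B.inv a) z + B.star a (B.star (B.inv a) z)) := by abel
    _ = z := by rw [← h, add_zero]

lemma li_eq' (a z : A) : B.li a z = z - B.star a (B.li a z) := by
  rw [eq_sub_iff_add_eq]; exact B.li_eq a z

lemma li_add (a y z : A) : B.li a (y + z) = B.li a y + B.li a z := by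
  unfold li; rw [star_add]; abel

lemma li_lam (a z : A) : B.li a (z + B.star a z) = z := by
  have h := B.star_circ (B.inv a) a z
  rw [inv_circ, one_eq, zero_star] at h
  unfold li
  rw [star_add]
  calc _ = z + (B.star (B.inv a) z + B.star a z + B.star (B.inv a) (B.star a z)) := by abel
    _ = z := by rw [← h, add_zero]

/-- nilpotency -/
def Nil (N : ℕ) : Prop := ∀ (l : List A) (b : A), N ≤ l.length → leftProd B.star l b = 0

lemma li_mem {N : ℕ} (hN : B.Nil N) (S : AddSubgroup A) (w : A)
    (hw : ∀ s ∈ S, B.star w s ∈ S) (u : A) (hu : u ∈ S) : B.li w u ∈ S := by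
  have key : ∀ j : ℕ, ∃ s ∈ S, B.li w u = s + leftProd B.star (List.replicate j w) (B.li w u) ∨
      B.li w u = s - leftProd B.star (List.replicate j w) (B.li w u) := by
    intro j
    induction j with
    | zero => exact ⟨0, S.zero_mem, Or.inl (by simp [leftProd])⟩
    | succ j ih =>
      obtain ⟨s, hs, h⟩ := ih
      refine ⟨u - B.star w s, S.sub_mem hu (hw s hs), ?_⟩
      rcases h with h | h
      · right
        have h2 := B.li_eq' w u
        have h3 := congrArg (B.star w) h
        rw [star_add] at h3
        rw [h3] at h2
        rw [List.replicate_succ, leftProd]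
        exact h2.trans (by abel)
      · left
        have h2 := B.li_eq' w u
        have h3 := congrArg (B.star w) h
        rw [star_sub] at h3
        rw [h3] at h2
        rw [List.replicate_succ, leftProd]
        exact h2.trans (by abel)
  obtain ⟨s, hs, h⟩ := key N
  rw [hN _ _ (by simp)] at h
  rcases h with h | h <;> rw [h] <;> simpa using hs

/-- peeling a positive word -/
lemma peel_pos (w y z : A) :
    B.star (w + y) z = B.star w z + B.star (B.li w y) z + B.star w (B.star (B.li w y) z) := by
  rw [← star_circ, circ_eq, add_assoc, li_eq]

/-- peeling a negative word -/
lemma peel_neg (w y z : A) :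
    B.star (-w + y) z + z = B.li w (z + B.star (y + B.star w (-w + y)) z) := by
  have h : B.circ w (-w + y) = y + B.star w (-w + y) := by
    rw [circ_eq]; abel
  rw [← h, star_circ]
  rw [← B.li_lam w (B.star (-w + y) z + z), star_add]
  congr 1; abel

end LeftBrace

/-- left degree of a word -/
def ldeg {α : Type*} : FreeMagma α → ℕ
  | FreeMagma.of _ => 0
  | FreeMagma.mul _ y => ldeg y + 1

lemma ldeg_lt_count (w : FreeMagma (Fin 2)) (h : wCount 1 w = 0) : ldeg w + 1 ≤ wCount 0 w := by
  induction w with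
  | ih1 i => fin_cases i <;> simp_all [wCount, ldeg]
  | ih2 x y hx hy =>
    change wCount 1 x + wCount 1 y = 0 at h
    change ldeg y + 1 + 1 ≤ wCount 0 x + wCount 0 y
    have := hx (by omega)
    have := hy (by omega)
    omega

namespace LeftBrace
variable {A : Type u} [AddCommGroup A] (B : LeftBrace A)

/-- span of `X`-words of left degree at least `k` -/
def V (a c : A) (k : ℕ) : AddSubgroup A :=
  AddSubgroup.closure (wEval B.star ![a, c] '' {w | wCount (1 : Fin 2) w = 0 ∧ k ≤ ldeg w})

/-- span of words with `Z` once at the end and at least `j` letters `X` -/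
def T (a c : A) (j : ℕ) : AddSubgroup A :=
  AddSubgroup.closure (wEval B.star ![a, c] ''
    {w | wLast w = (1 : Fin 2) ∧ wCount (1 : Fin 2) w = 1 ∧ j ≤ wCount (0 : Fin 2) w})

variable (a c : A)

lemma T_anti {i j : ℕ} (h : i ≤ j) : B.T a c j ≤ B.T a c i :=
  AddSubgroup.closure_mono (Set.image_mono fun _ hw => ⟨hw.1, hw.2.1, h.trans hw.2.2⟩)

lemma V_anti {i j : ℕ} (h : i ≤ j) : B.V a c j ≤ B.V a c i :=
  AddSubgroup.closure_mono (Set.image_mono fun _ hw => ⟨hw.1, h.trans hw.2⟩)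

lemma star_mem_V (w : FreeMagma (Fin 2)) (hw : wCount 1 w = 0) (k : ℕ) (y : A)
    (hy : y ∈ B.V a c k) : B.star (wEval B.star ![a, c] w) y ∈ B.V a c (k + 1) := by
  induction hy using AddSubgroup.closure_induction with
  | mem x hx =>
    obtain ⟨v, ⟨h1, h2⟩, rfl⟩ := hx
    exact AddSubgroup.subset_closure ⟨FreeMagma.mul w v,
      ⟨by simp [wCount, hw, h1], by simp [ldeg, h2]⟩, rfl⟩
  | zero => rw [star_zero]; exact zero_mem _
  | add x y _ _ hx hy => rw [star_add]; exact add_mem hx hy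
  | neg x _ hx => rw [star_neg]; exact neg_mem hx

lemma star_mem_T (w : FreeMagma (Fin 2)) (hw : wCount 1 w = 0) (i j : ℕ) (hi : i ≤ wCount 0 w)
    (y : A) (hy : y ∈ B.T a c j) : B.star (wEval B.star ![a, c] w) y ∈ B.T a c (j + i) := by
  induction hy using AddSubgroup.closure_induction with
  | mem x hx =>
    obtain ⟨v, ⟨h1, h2, h3⟩, rfl⟩ := hx
    refine AddSubgroup.subset_closure ⟨FreeMagma.mul w v,
      ⟨h1, by simp [wCount, hw, h2], ?_⟩, rfl⟩
    simp only [wCount]; omega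
  | zero => rw [star_zero]; exact zero_mem _
  | add x y _ _ hx hy => rw [star_add]; exact add_mem hx hy
  | neg x _ hx => rw [star_neg]; exact neg_mem hx

lemma eval_leftProd (w : FreeMagma (Fin 2)) :
    ∃ (l : List A) (b : A), l.length = ldeg w ∧
      wEval B.star ![a, c] w = leftProd B.star l b := by
  induction w with
  | ih1 i => exact ⟨[], _, rfl, rfl⟩
  | ih2 x y _ hy =>
    obtain ⟨l, b, h1, h2⟩ := hy
    refine ⟨wEval B.star ![a, c] x :: l, b, by simp [ldeg, h1], ?_⟩
    change B.star _ (wEval B.star ![a, c] y) = _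
    rw [h2]; rfl

lemma V_nil {N : ℕ} (hN : B.Nil N) (y : A) (hy : y ∈ B.V a c N) : y = 0 := by
  induction hy using AddSubgroup.closure_induction with
  | mem x hx =>
    obtain ⟨v, ⟨h1, h2⟩, rfl⟩ := hx
    obtain ⟨l, b, h3, h4⟩ := B.eval_leftProd a c v
    rw [h4]; exact hN _ _ (h3 ▸ h2)
  | zero => rfl
  | add x y _ _ hx hy => rw [hx, hy, add_zero]
  | neg x _ hx => rw [hx, neg_zero]

lemma li_sub_V {N : ℕ} (hN : B.Nil N) (w : FreeMagma (Fin 2)) (hw : wCount 1 w = 0) (k : ℕ) (y : A)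
    (hy : y ∈ B.V a c k) :
    B.li (wEval B.star ![a, c] w) y - y ∈ B.V a c (k + 1) := by
  rw [B.li_eq', sub_sub_cancel_left]
  refine neg_mem (B.star_mem_V a c w hw k _ (B.li_mem hN _ _ ?_ _ hy))
  intro s hs
  exact B.V_anti a c (Nat.le_succ k) (B.star_mem_V a c w hw k _ hs)

lemma li_mem_T {N : ℕ} (hN : B.Nil N) (w : FreeMagma (Fin 2)) (hw : wCount 1 w = 0) (j : ℕ) (y : A)
    (hy : y ∈ B.T a c j) :
    B.li (wEval B.star ![a, c] w) y ∈ B.T a c j :=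
  B.li_mem hN _ _ (fun s hs => B.star_mem_T a c w hw 0 j (Nat.zero_le _) s hs) _ hy

lemma li_sub_T {N : ℕ} (hN : B.Nil N) (w : FreeMagma (Fin 2)) (hw : wCount 1 w = 0) (i j : ℕ)
    (hi : i ≤ wCount 0 w) (y : A) (hy : y ∈ B.T a c j) :
    B.li (wEval B.star ![a, c] w) y - y ∈ B.T a c (j + i) := by
  rw [B.li_eq', sub_sub_cancel_left]
  exact neg_mem (B.star_mem_T a c w hw i j hi _ (B.li_mem_T a c hN w hw j _ hy))

lemma main_step {N : ℕ} (hN : B.Nil N) (k : ℕ) (hk : 1 ≤ k)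
    (ih : ∀ y ∈ B.V a c (k + 1), ∀ z ∈ B.T a c 0, B.star y z ∈ B.T a c 2) :
    ∀ y ∈ B.V a c k, ∀ z ∈ B.T a c 0, B.star y z ∈ B.T a c 2 := by
  have key : ∀ y ∈ B.V a c k, y ∈ B.V a c k ∧
      ∀ r ∈ B.V a c (k + 1), ∀ z ∈ B.T a c 0, B.star (y + r) z ∈ B.T a c 2 := by
    intro y hy
    induction hy using AddSubgroup.closure_induction_left with
    | zero => exact ⟨zero_mem _, fun r hr z hz => by rw [zero_add]; exact ih r hr z hz⟩
    | add_left x hx y hy IH =>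
      obtain ⟨hyV, IH⟩ := IH
      refine ⟨add_mem (AddSubgroup.subset_closure hx) hyV, ?_⟩
      obtain ⟨w, ⟨h1, h2⟩, rfl⟩ := hx
      intro r hr z hz
      have hc : 2 ≤ wCount 0 w := by have := ldeg_lt_count w h1; omega
      have hyr : y + r ∈ B.V a c k := add_mem hyV (B.V_anti a c (Nat.le_succ k) hr)
      have h3 := B.li_sub_V a c hN w h1 k _ hyr
      have h4 := IH _ (add_mem hr h3) z hz
      rw [← add_assoc, add_sub_cancel] at h4
      rw [add_assoc, peel_pos]
      exact add_mem (add_mem (B.star_mem_T a c w h1 2 0 hc z hz) h4)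
        (B.star_mem_T a c w h1 0 2 (Nat.zero_le _) _ h4)
    | neg_add_cancel x hx y hy IH =>
      obtain ⟨hyV, IH⟩ := IH
      have hxV : x ∈ B.V a c k := AddSubgroup.subset_closure hx
      refine ⟨add_mem (neg_mem hxV) hyV, ?_⟩
      obtain ⟨w, ⟨h1, h2⟩, rfl⟩ := hx
      intro r hr z hz
      have hc : 2 ≤ wCount 0 w := by have := ldeg_lt_count w h1; omega
      have hyr : y + r ∈ B.V a c k := add_mem hyV (B.V_anti a c (Nat.le_succ k) hr)
      have h3 := B.star_mem_V a c w h1 k _ (add_mem (neg_mem hxV) hyr)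
      have h4 := IH _ (add_mem hr h3) z hz
      rw [← add_assoc] at h4
      rw [add_assoc, ← add_sub_cancel_right (B.star _ z) z, peel_neg, li_add,
        add_sub_right_comm]
      exact add_mem (B.li_sub_T a c hN w h1 2 0 hc z hz) (B.li_mem_T a c hN w h1 2 _ h4)
  intro y hy z hz
  have := (key y hy).2 0 (zero_mem _) z hz
  rwa [add_zero] at this

lemma V_one_star {N : ℕ} (hN : B.Nil N) :
    ∀ y ∈ B.V a c 1, ∀ z ∈ B.T a c 0, B.star y z ∈ B.T a c 2 := by
  have key : ∀ d k : ℕ, 1 ≤ k → N ≤ k + d →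
      ∀ y ∈ B.V a c k, ∀ z ∈ B.T a c 0, B.star y z ∈ B.T a c 2 := by
    intro d
    induction d with
    | zero =>
      intro k _ h y hy z _
      rw [B.V_nil a c hN y (B.V_anti a c h hy), zero_star]
      exact zero_mem _
    | succ d ih =>
      intro k hk h
      exact B.main_step a c hN k hk (ih (k + 1) (by omega) (by omega))
  exact key N 1 le_rfl (by omega)

lemma main_single {N : ℕ} (hN : B.Nil N) (m : ℤ) :
    ∀ r ∈ B.V a c 1, B.star (m • a + r) c - m • B.star a c ∈ B.T a c 2 := by
  have hcT : c ∈ B.T a c 0 :=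
    AddSubgroup.subset_closure ⟨FreeMagma.of 1, ⟨rfl, rfl, Nat.zero_le _⟩, rfl⟩
  have haV : a ∈ B.V a c 0 :=
    AddSubgroup.subset_closure ⟨FreeMagma.of 0, ⟨rfl, Nat.zero_le _⟩, rfl⟩
  have hs : ∀ j y, y ∈ B.T a c j → B.star a y ∈ B.T a c (j + 1) := fun j y hy =>
    B.star_mem_T a c (FreeMagma.of 0) rfl 1 j le_rfl y hy
  have hacT : B.star a c ∈ B.T a c 1 := hs 0 c hcT
  have hl : ∀ j y, y ∈ B.T a c j → B.li a y - y ∈ B.T a c (j + 1) := fun j y hy =>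
    B.li_sub_T a c hN (FreeMagma.of 0) rfl 1 j le_rfl y hy
  have hl0 : ∀ j y, y ∈ B.T a c j → B.li a y ∈ B.T a c j := fun j y hy =>
    B.li_mem_T a c hN (FreeMagma.of 0) rfl j y hy
  have hsV : ∀ k y, y ∈ B.V a c k → B.star a y ∈ B.V a c (k + 1) := fun k y hy =>
    B.star_mem_V a c (FreeMagma.of 0) rfl k y hy
  have hlV : ∀ k y, y ∈ B.V a c k → B.li a y - y ∈ B.V a c (k + 1) := fun k y hy =>
    B.li_sub_V a c hN (FreeMagma.of 0) rfl k y hy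
  have V10 : ∀ y, y ∈ B.V a c 1 → y ∈ B.V a c 0 := fun y hy => B.V_anti a c (Nat.zero_le 1) hy
  have up : ∀ m : ℤ, (∀ r ∈ B.V a c 1, B.star (m • a + r) c - m • B.star a c ∈ B.T a c 2) →
      ∀ r ∈ B.V a c 1, B.star ((m + 1) • a + r) c - (m + 1) • B.star a c ∈ B.T a c 2 := by
    intro m ih r hr
    have h3 := hlV 0 (m • a + r) (add_mem (zsmul_mem haV m) (V10 _ hr))
    have h4 := ih _ (add_mem hr h3)
    rw [← add_assoc, add_sub_cancel] at h4
    have h5 := B.T_anti a c (Nat.le_succ 2) (hs 2 _ h4)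
    have h6 := hs 1 _ (zsmul_mem hacT m)
    have h7 := add_mem h4 (add_mem h5 h6)
    rw [← star_add, sub_add_cancel] at h7
    have e : (m + 1) • a + r = a + (m • a + r) := by rw [add_zsmul, one_zsmul]; abel
    rw [e, peel_pos, add_zsmul, one_zsmul]
    convert h7 using 1
    abel
  have down : ∀ m : ℤ, (∀ r ∈ B.V a c 1, B.star (m • a + r) c - m • B.star a c ∈ B.T a c 2) →
      ∀ r ∈ B.V a c 1, B.star ((m - 1) • a + r) c - (m - 1) • B.star a c ∈ B.T a c 2 := by
    intro m ih r hr
    have h3 := hsV 0 (-a + (m • a + r))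
      (add_mem (neg_mem haV) (add_mem (zsmul_mem haV m) (V10 _ hr)))
    have h4 := ih _ (add_mem hr h3)
    rw [← add_assoc] at h4
    have e : (m - 1) • a + r = -a + (m • a + r) := by rw [sub_zsmul, one_zsmul]; abel
    rw [e, ← add_sub_cancel_right (B.star _ c) c, peel_neg]
    set q := B.star (m • a + r + B.star a (-a + (m • a + r))) c with hq
    have e2 : B.li a (c + q) = B.li a c + B.li a (m • B.star a c) + B.li a (q - m • B.star a c) := by
      rw [← li_add, ← li_add]; congr 1; abel
    have h5 := hl0 2 _ h4
    have h6 := hl 1 _ (zsmul_mem hacT m)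
    have h7 := hs 1 _ (hl0 1 _ hacT)
    have e3 : B.li a c = c - B.star a c + B.star a (B.li a (B.star a c)) := by
      have e4 : B.li a c + B.li a (B.star a c) = c := by rw [← li_add, li_lam]
      rw [eq_sub_of_add_eq e4, B.li_eq' a (B.star a c)]
      have := B.li_eq' a (B.star a c)
      rw [← this]
      rw [sub_add, sub_right_inj]; exact this
    rw [e2, e3, sub_zsmul, one_zsmul]
    convert add_mem (add_mem h5 h6) h7 using 1
    abel
  induction m using Int.induction_on with
  | zero =>
    intro r hr
    simpa using B.V_one_star a c hN r hr c hcT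
  | succ i ih => exact up _ ih
  | pred i ih => exact down _ ih

/-- The circle group -/
@[reducible] def grp : Group A :=
  letI : Mul A := ⟨B.circ⟩
  letI : One A := ⟨B.one⟩
  letI : Inv A := ⟨B.inv⟩
  Group.ofLeftAxioms B.circ_assoc B.one_circ B.inv_circ

/-- ascending chain -/
def Zc : ℕ → AddSubgroup A
  | 0 => ⊥
  | i + 1 =>
    { carrier := {x | ∀ g, B.star g x ∈ Zc i}
      zero_mem' := fun g => by rw [star_zero]; exact zero_mem _
      add_mem' := fun hx hy g => by rw [star_add]; exact add_mem (hx g) (hy g)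
      neg_mem' := fun hx g => by rw [star_neg]; exact neg_mem (hx g) }

lemma Zc_le (i : ℕ) : B.Zc i ≤ B.Zc (i + 1) := by
  induction i with
  | zero => exact bot_le
  | succ i ih => exact fun x hx g => ih (hx g)

/-- the action by `λ` -/
def lamHom (g : A) : A →+ A where
  toFun x := x + B.star g x
  map_zero' := by rw [star_zero, add_zero]
  map_add' x y := by rw [star_add]; abel

lemma fixed_quot {p n : ℕ} (hp : p.Prime) (hA : Nat.card A = p ^ n) (Z : AddSubgroup A)
    (hZ : ∀ g, ∀ x ∈ Z, B.star g x ∈ Z) (hne : Z ≠ ⊤) :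
    ∃ x, x ∉ Z ∧ ∀ g, B.star g x ∈ Z := by
  haveI : Fact p.Prime := ⟨hp⟩
  haveI : Finite A := Nat.finite_of_card_ne_zero (by rw [hA]; exact pow_ne_zero _ hp.ne_zero)
  letI : Group A := B.grp
  have hle : ∀ g, Z ≤ Z.comap (B.lamHom g) := fun g x hx => add_mem hx (hZ g x hx)
  letI act : MulAction A (A ⧸ Z) :=
    { smul := fun g x => QuotientAddGroup.map Z Z (B.lamHom g) (hle g) x
      one_smul := by
        intro x
        induction x using QuotientAddGroup.induction_on with
        | H x =>
          change ((x + B.star B.one x : A) : A ⧸ Z) = x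
          rw [one_eq, zero_star, add_zero]
      mul_smul := by
        intro g h x
        induction x using QuotientAddGroup.induction_on with
        | H x =>
          change ((x + B.star (B.circ g h) x : A) : A ⧸ Z) =
            ((x + B.star h x + B.star g (x + B.star h x) : A) : A ⧸ Z)
          rw [star_circ, star_add]
          congr 1; abel }
  have hP : IsPGroup p A := IsPGroup.of_card hA
  have hd : p ∣ Nat.card (A ⧸ Z) := by
    have h1 : Nat.card (A ⧸ Z) ∣ p ^ n := hA ▸ AddSubgroup.card_quotient_dvd_card Z
    obtain ⟨k, -, hk⟩ := (Nat.dvd_prime_pow hp).1 h1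
    rcases Nat.eq_zero_or_pos k with rfl | hk0
    · exact absurd (AddSubgroup.index_eq_one.1 (hk.trans (pow_zero p))) hne
    · rw [hk]; exact dvd_pow_self p hk0.ne'
  have h0 : (0 : A ⧸ Z) ∈ MulAction.fixedPoints A (A ⧸ Z) := fun g =>
    map_zero (QuotientAddGroup.map Z Z (B.lamHom g) (hle g))
  obtain ⟨b, hb, hb0⟩ := hP.exists_fixed_point_of_prime_dvd_card_of_fixed_point (A ⧸ Z) hd h0
  induction b using QuotientAddGroup.induction_on with
  | H x =>
    refine ⟨x, fun hx => hb0 ((QuotientAddGroup.eq_zero_iff x).2 hx).symm, fun g => ?_⟩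
    have h : ((x + B.star g x : A) : A ⧸ Z) = x := hb g
    have h2 := QuotientAddGroup.eq.1 h.symm
    rwa [neg_add_cancel_left] at h2

lemma nil_of_card {p n : ℕ} (hp : p.Prime) (hA : Nat.card A = p ^ n) : B.Nil n := by
  haveI : Finite A := Nat.finite_of_card_ne_zero (by rw [hA]; exact pow_ne_zero _ hp.ne_zero)
  have hcard : ∀ i, B.Zc i = ⊤ ∨ p ^ i ∣ Nat.card (B.Zc i) := by
    intro i
    induction i with
    | zero => right; simp
    | succ i ih =>
      by_cases htop : B.Zc i = ⊤
      · left; exact top_le_iff.1 (htop ▸ B.Zc_le i)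
      right
      have hd := ih.resolve_left htop
      obtain ⟨x, hx, hx2⟩ := B.fixed_quot hp hA (B.Zc i) (fun g x hx => B.Zc_le i hx g) htop
      have hlt : B.Zc i < B.Zc (i + 1) :=
        lt_of_le_of_ne (B.Zc_le i) (fun h => hx (h ▸ (show x ∈ B.Zc (i + 1) from hx2)))
      have hclt : Nat.card (B.Zc i) < Nat.card (B.Zc (i + 1)) :=
        Set.ncard_lt_ncard (SetLike.coe_ssubset_coe.2 hlt) (Set.toFinite _)
      have hdv : Nat.card (B.Zc (i + 1)) ∣ p ^ n := hA ▸ AddSubgroup.card_addSubgroup_dvd_card _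
      obtain ⟨k, -, hk⟩ := (Nat.dvd_prime_pow hp).1 hdv
      rw [hk] at hclt ⊢
      have h1 : p ^ i < p ^ k := lt_of_le_of_lt (Nat.le_of_dvd Nat.card_pos hd) hclt
      exact pow_dvd_pow p ((Nat.pow_lt_pow_iff_right hp.one_lt).1 h1)
  have htop : B.Zc n = ⊤ := by
    rcases hcard n with h | h
    · exact h
    · refine AddSubgroup.eq_top_of_le_card _ ?_
      rw [hA]; exact Nat.le_of_dvd Nat.card_pos h
  have hmem : ∀ (l : List A) (b : A) (i : ℕ), l.length + i = n → leftProd B.star l b ∈ B.Zc i := by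
    intro l
    induction l with
    | nil =>
      intro b i h
      have : i = n := by simpa using h
      subst this
      rw [htop]; trivial
    | cons g l ih =>
      intro b i h
      exact ih b (i + 1) (by simp at h; omega) g
  intro l b hl
  induction l with
  | nil =>
    have h0 : n = 0 := by simpa using hl
    have h1 : leftProd B.star ([] : List A) b ∈ B.Zc 0 := hmem [] b 0 (by simp [h0])
    exact h1
  | cons g l ih =>
    rcases Nat.lt_or_ge l.length n with h | h
    · have h1 : leftProd B.star (g :: l) b ∈ B.Zc 0 := hmem (g :: l) b 0 (by simp at hl ⊢; omega)
      exact h1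
    · change B.star g (leftProd B.star l b) = 0
      rw [ih h, star_zero]

end LeftBrace

/-- all contexts at once -/
structure BCtx (N : ℕ) : Type (u + 1) where
  A : Type u
  inst : AddCommGroup A
  B : LeftBrace A
  nil : B.Nil N
  a : A
  c : A

instance (N : ℕ) (x : BCtx.{u} N) : AddCommGroup x.A := x.inst

/-- the product of all contexts -/
def prodBrace (N : ℕ) : LeftBrace (∀ x : BCtx.{u} N, x.A) where
  circ f g := fun x => x.B.circ (f x) (g x)
  one := fun x => x.B.one
  inv f := fun x => x.B.inv (f x)
  circ_assoc f g h := funext fun x => x.B.circ_assoc _ _ _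
  one_circ f := funext fun x => x.B.one_circ _
  circ_one f := funext fun x => x.B.circ_one _
  inv_circ f := funext fun x => x.B.inv_circ _
  circ_add f g h := funext fun x => x.B.circ_add _ _ _

lemma prodBrace_leftProd (N : ℕ) (l : List (∀ x : BCtx.{u} N, x.A)) (b : ∀ x : BCtx.{u} N, x.A)
    (x : BCtx.{u} N) :
    leftProd (prodBrace N).star l b x = leftProd x.B.star (l.map (fun f => f x)) (b x) := by
  induction l with
  | nil => rfl
  | cons g l ih =>
    change x.B.star (g x) (leftProd (prodBrace N).star l b x) = _
    rw [ih]; rfl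

lemma prodBrace_nil (N : ℕ) : (prodBrace.{u} N).Nil N := by
  intro l b hl
  funext x
  rw [prodBrace_leftProd]
  exact x.nil _ _ (by simpa using hl)

lemma prodBrace_eval (N : ℕ) (f g : ∀ x : BCtx.{u} N, x.A) (w : FreeMagma (Fin 2))
    (x : BCtx.{u} N) :
    wEval (prodBrace N).star ![f, g] w x = wEval x.B.star ![f x, g x] w := by
  induction w with
  | ih1 i => fin_cases i <;> rfl
  | ih2 u v hu hv =>
    change x.B.star (wEval (prodBrace N).star ![f, g] u x)
      (wEval (prodBrace N).star ![f, g] v x) = _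
    rw [hu, hv]; rfl

/-- for a fixed prime `p` and integer `m` there are integers `γ_w`
(finitely many nonzero), indexed by words in `X,Z` (variables `0,1` of `Fin 2`) with `Z`
exactly once at the end and `X` at least twice, such that for every left brace of
cardinality `p^n` with `p > n+1` and all `a,c ∈ A`:
`(m·a)*c = m·(a*c) + Σ_w γ_w·w⟨a,c⟩`. -/
theorem stmt_18 (p : ℕ) (hp : p.Prime) (m : ℤ) :
    ∃ (S : Finset (FreeMagma (Fin 2))) (g : FreeMagma (Fin 2) → ℤ),
      (∀ w ∈ S, wLast w = (1 : Fin 2) ∧ wCount (1 : Fin 2) w = 1 ∧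
        2 ≤ wCount (0 : Fin 2) w) ∧
      ∀ (n : ℕ), n + 1 < p →
        ∀ (A : Type u) [AddCommGroup A] (B : LeftBrace A), Nat.card A = p ^ n →
          ∀ a c : A,
            B.star (m • a) c = m • B.star a c + ∑ w ∈ S, g w • wEval B.star ![a, c] w := by
  classical
  set a : ∀ x : BCtx.{u} p, x.A := fun x => x.a with ha
  set c : ∀ x : BCtx.{u} p, x.A := fun x => x.c with hc
  have h := (prodBrace.{u} p).main_single a c (prodBrace_nil p) m 0 (zero_mem _)
  rw [LeftBrace.T, ← Submodule.span_int_eq_addSubgroupClosure, Submodule.mem_toAddSubgroup,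
    Finsupp.mem_span_image_iff_linearCombination] at h
  obtain ⟨f, hf, hfe⟩ := h
  refine ⟨f.support, f, fun w hw => (Finsupp.mem_supported ℤ f).1 hf hw, ?_⟩
  intro n hn A _ B hA a₁ c₁
  have hnil : B.Nil p := fun l b hl => B.nil_of_card hp hA l b (by omega)
  have h2 := congrFun hfe (⟨A, inferInstance, B, hnil, a₁, c₁⟩ : BCtx.{u} p)
  rw [Finsupp.linearCombination_apply, Finsupp.sum, Finset.sum_apply, add_zero] at h2
  simp only [Pi.smul_apply, prodBrace_eval] at h2
  have h3 : _ = B.star (m • a₁) c₁ - m • B.star a₁ c₁ := h2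
  rw [eq_sub_iff_add_eq'] at h3
  exact h3.symm
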